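/- Let k ∈ ℕ with k ≥ 2 and γ ∈ (0,1). Assume D₀ ⊂ ℝ² is a bounded simply connected domain whose boundary is characterized by a level-set function φ₀ ∈ C^{k,γ}(ℝ²) (∂D₀ = {φ₀ = 0}, D₀ = {φ₀ > 0}, ∇φ₀ ≠ 0 on ∂D₀), and let θ₀ = θ̄₀·1_{D₀} with θ̄₀ ∈ C^{k−2,γ}(cl D₀). Set W₀ = ∇^⊥φ₀. Then the (k−1)-fold striated derivative satisfies ∂_{W₀}^{k−1} θ₀ ∈ C^{−1,γ}(ℝ²) = B^{γ−1}_{∞,∞}(ℝ²). -/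

import Mathlib

open MeasureTheory Real Set Filter Topology FourierTransform
open scoped ENNReal NNReal

noncomputable section

/-- `ℝ^d` as a Euclidean space. -/
abbrev Rd (d : ℕ) : Type := EuclideanSpace ℝ (Fin d)

namespace Paper

variable {d : ℕ}

/-- the `i`-th standard basis vector of `ℝ^d`. -/
def e (d : ℕ) (i : Fin d) : Rd d := EuclideanSpace.single i 1

/-- partial derivative of a complex-valued function. -/
def pd (i : Fin d) (f : Rd d → ℂ) (x : Rd d) : ℂ := fderiv ℝ f x (e d i)

/-- partial derivative of a real-valued function. -/
def pdR (i : Fin d) (f : Rd d → ℝ) (x : Rd d) : ℝ := fderiv ℝ f x (e d i)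

/-- view a real-valued function as a complex-valued one -/
def toC (f : Rd d → ℝ) : Rd d → ℂ := fun x => (f x : ℂ)

/-- the gradient of a real scalar function, as a vector field -/
def gradV (φ : Rd d → ℝ) (x : Rd d) : Rd d :=
  (EuclideanSpace.equiv (Fin d) ℝ).symm (fun i => pdR i φ x)

/-- the transport term `u · ∇ φ` -/
def adv (u : Rd d → Rd d) (φ : Rd d → ℝ) (x : Rd d) : ℝ := ∑ i, u x i * pdR i φ x

/-- directional derivative `W · ∇ f` of a complex valued function along a vector field -/
def dirD (W : Rd d → Rd d) (f : Rd d → ℂ) : Rd d → ℂ :=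
  fun x => ∑ i, (W x i : ℂ) * pd i f x

/-- directional derivative of a vector field along a vector field -/
def dirDV (W v : Rd d → Rd d) : Rd d → Rd d :=
  fun x => (EuclideanSpace.equiv (Fin d) ℝ).symm
    (fun i => ∑ j, W x j * pdR j (fun y => v y i) x)

/-- pointwise divergence free -/
def DivFree (u : Rd d → Rd d) : Prop := ∀ x, ∑ i, pdR i (fun y => u y i) x = 0

/-- Laplacian of a real scalar function -/
def lap (f : Rd d → ℝ) (x : Rd d) : ℝ := ∑ i, pdR i (fun y => pdR i f y) x

/-- supremum norm, valued in `ℝ≥0∞` -/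
def supNorm {α F : Type*} [NormedAddCommGroup F] (f : α → F) : ℝ≥0∞ :=
  ⨆ x, (‖f x‖₊ : ℝ≥0∞)

/-- Hölder seminorm of exponent `γ` -/
def hSemi {E F : Type*} [PseudoEMetricSpace E] [NormedAddCommGroup F] (γ : ℝ) (f : E → F) :
    ℝ≥0∞ :=
  ⨆ (x : E) (y : E), (‖f x - f y‖₊ : ℝ≥0∞) / (edist x y) ^ γ

/-- the Hölder norm `‖·‖_{C^γ}` -/
def cγ {E F : Type*} [PseudoEMetricSpace E] [NormedAddCommGroup F] (γ : ℝ) (f : E → F) : ℝ≥0∞ :=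
  supNorm f + hSemi γ f

/-- the `C^{k,γ}` Hölder norm -/
def ckγ (k : ℕ) (γ : ℝ) {F : Type*} [NormedAddCommGroup F] [NormedSpace ℝ F]
    (f : Rd d → F) : ℝ≥0∞ :=
  (∑ n ∈ Finset.range (k + 1), supNorm (iteratedFDeriv ℝ n f)) +
    hSemi γ (iteratedFDeriv ℝ k f)

/-- membership in `C^{k,γ}(ℝ^d)` -/
def MemCkγ (k : ℕ) (γ : ℝ) {F : Type*} [NormedAddCommGroup F] [NormedSpace ℝ F]
    (f : Rd d → F) : Prop :=
  ContDiff ℝ (k : ℕ∞) f ∧ ckγ k γ f < ⊤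

/-- `C^γ` norm of a function on a subset (used for `C^μ(cl D₀)`) -/
def cγOn {E F : Type*} [PseudoEMetricSpace E] [NormedAddCommGroup F] (γ : ℝ) (f : E → F)
    (A : Set E) : ℝ≥0∞ :=
  (⨆ x : A, (‖f (x : E)‖₊ : ℝ≥0∞)) +
    ⨆ (x : A) (y : A), (‖f (x : E) - f (y : E)‖₊ : ℝ≥0∞) / (edist (x : E) (y : E)) ^ γ

/-- a `W^{2,∞}`-type norm: sup norm of the function and of its gradient together with the
Lipschitz seminorm of the gradient. -/
def w2inf {F : Type*} [NormedAddCommGroup F] [NormedSpace ℝ F] (f : Rd d → F) : ℝ≥0∞ :=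
  supNorm f + supNorm (fun x => fderiv ℝ f x) + hSemi 1 (fun x => fderiv ℝ f x)

/-! ### Littlewood–Paley theory and Besov spaces -/

/-- A dyadic Littlewood–Paley partition of unity on `ℝ^d`:
nonnegative radial bump functions `χ, ϕ` supported respectively in `{|ξ| ≤ 4/3}` and
`{3/4 ≤ |ξ| ≤ 8/3}` with `χ(ξ) + ∑_{j ≥ 0} ϕ(2^{-j}ξ) = 1`. -/
structure LPData (d : ℕ) where
  chi : Rd d → ℝ
  phi : Rd d → ℝ
  chi_smooth : ContDiff ℝ (⊤ : ℕ∞) chi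
  phi_smooth : ContDiff ℝ (⊤ : ℕ∞) phi
  chi_nonneg : ∀ ξ, 0 ≤ chi ξ
  phi_nonneg : ∀ ξ, 0 ≤ phi ξ
  chi_radial : ∀ ξ η : Rd d, ‖ξ‖ = ‖η‖ → chi ξ = chi η
  phi_radial : ∀ ξ η : Rd d, ‖ξ‖ = ‖η‖ → phi ξ = phi η
  chi_support : ∀ ξ : Rd d, chi ξ ≠ 0 → ‖ξ‖ ≤ 4 / 3
  phi_support : ∀ ξ : Rd d, phi ξ ≠ 0 → 3 / 4 ≤ ‖ξ‖ ∧ ‖ξ‖ ≤ 8 / 3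
  partition : ∀ ξ : Rd d, chi ξ + ∑' j : ℕ, phi ((2 : ℝ) ^ (-(j : ℤ)) • ξ) = 1

/-- the symbol of the dyadic block `Δ_q`, `q ≥ -1` -/
def LPData.symb (P : LPData d) (q : ℤ) (ξ : Rd d) : ℝ :=
  if q = -1 then P.chi ξ else P.phi ((2 : ℝ) ^ (-q) • ξ)

/-- Fourier multiplier operator with symbol `m` -/
def fm (m : Rd d → ℂ) (f : Rd d → ℂ) : Rd d → ℂ :=
  𝓕⁻ (fun ξ => m ξ * 𝓕 f ξ)

/-- the dyadic block `Δ_q` -/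
def LPData.block (P : LPData d) (q : ℤ) (f : Rd d → ℂ) : Rd d → ℂ :=
  fm (fun ξ => (P.symb q ξ : ℂ)) f

/-- the low frequency cut-off `S_j = ∑_{-1 ≤ l ≤ j-1} Δ_l` -/
def LPData.low (P : LPData d) (j : ℤ) (f : Rd d → ℂ) : Rd d → ℂ :=
  fun x => ∑ l ∈ Finset.Icc (-1 : ℤ) (j - 1), P.block l f x

/-- `ℓ^r` norm of a sequence of extended nonnegative reals -/
def seqLr (r : ℝ≥0∞) (a : ℤ → ℝ≥0∞) : ℝ≥0∞ :=
  if r = ⊤ then ⨆ q, a q else (∑' q, a q ^ r.toReal) ^ (1 / r.toReal)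

/-- the weight `2^{qs}` -/
def dyadic (s : ℝ) (q : ℤ) : ℝ≥0∞ := ENNReal.ofReal ((2 : ℝ) ^ ((q : ℝ) * s))

/-- the nonhomogeneous Besov norm `‖f‖_{B^s_{p,r}}` -/
def besov (P : LPData d) (s : ℝ) (p r : ℝ≥0∞) (f : Rd d → ℂ) : ℝ≥0∞ :=
  seqLr r (fun q => if -1 ≤ q then dyadic s q * eLpNorm (P.block q f) p volume else 0)

/-- Besov norm of a real valued function -/
def besovR (P : LPData d) (s : ℝ) (p r : ℝ≥0∞) (f : Rd d → ℝ) : ℝ≥0∞ := besov P s p r (toC f)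

/-- Besov norm of a vector field (sum over the components) -/
def besovV (P : LPData d) (s : ℝ) (p r : ℝ≥0∞) (u : Rd d → Rd d) : ℝ≥0∞ :=
  ∑ i, besovR P s p r (fun x => u x i)

/-- Besov norm of a gradient `‖∇φ‖_{B^s_{p,r}}` (sum over the components) -/
def besovGrad (P : LPData d) (s : ℝ) (p r : ℝ≥0∞) (φ : Rd d → ℝ) : ℝ≥0∞ :=
  ∑ i, besovR P s p r (fun x => pdR i φ x)

/-! ### Striated Besov spaces -/

/-- iterated directional derivatives `∂_{W_1}^{λ_1} ⋯ ∂_{W_N}^{λ_N} f` -/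
def multiD {N : ℕ} (W : Fin N → Rd d → Rd d) (lam : Fin N → ℕ) (f : Rd d → ℂ) : Rd d → ℂ :=
  ((List.ofFn fun i : Fin N => (fun g : Rd d → ℂ => (dirD (W i))^[lam i] g)).foldr
    (· ∘ ·) id) f

/-- the striated Besov norm `‖f‖_{𝓑^{s,ℓ}_{p,r,𝒲}}` -/
def sBesov (P : LPData d) {N : ℕ} (W : Fin N → Rd d → Rd d) (s : ℝ) (p r : ℝ≥0∞) (ℓ : ℕ)
    (f : Rd d → ℂ) : ℝ≥0∞ :=
  ∑ lam ∈ Finset.univ.filter (fun lam : Fin N → Fin (ℓ + 1) => ∑ i, (lam i : ℕ) ≤ ℓ),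
    besov P s p r (multiD W (fun i => (lam i : ℕ)) f)

def sBesovR (P : LPData d) {N : ℕ} (W : Fin N → Rd d → Rd d) (s : ℝ) (p r : ℝ≥0∞) (ℓ : ℕ)
    (f : Rd d → ℝ) : ℝ≥0∞ :=
  sBesov P W s p r ℓ (toC f)

/-- striated Besov norm of a vector field (sum over components) -/
def sBesovV (P : LPData d) {N : ℕ} (W : Fin N → Rd d → Rd d) (s : ℝ) (p r : ℝ≥0∞) (ℓ : ℕ)
    (u : Rd d → Rd d) : ℝ≥0∞ :=
  ∑ c, sBesovR P W s p r ℓ (fun x => u x c)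

/-- striated Besov norm `‖∇φ‖_{𝓑^{s,ℓ}_{p,r,𝒲}}` of a gradient -/
def sBesovGrad (P : LPData d) {N : ℕ} (W : Fin N → Rd d → Rd d) (s : ℝ) (p r : ℝ≥0∞) (ℓ : ℕ)
    (φ : Rd d → ℝ) : ℝ≥0∞ :=
  ∑ c, sBesovR P W s p r ℓ (fun x => pdR c φ x)

/-- striated Besov norm `‖∇u‖_{𝓑^{s,ℓ}_{p,r,𝒲}}` of the gradient of a vector field -/
def sBesovGradV (P : LPData d) {N : ℕ} (W : Fin N → Rd d → Rd d) (s : ℝ) (p r : ℝ≥0∞) (ℓ : ℕ)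
    (u : Rd d → Rd d) : ℝ≥0∞ :=
  ∑ c, ∑ j, sBesovR P W s p r ℓ (fun x => pdR j (fun y => u y c) x)

/-- the striated norm `‖𝒲‖_{𝓑^{s,ℓ}_{p,r,𝒲}}` of the whole family -/
def sBesovFam (P : LPData d) {N : ℕ} (W : Fin N → Rd d → Rd d) (s : ℝ) (p r : ℝ≥0∞) (ℓ : ℕ) :
    ℝ≥0∞ :=
  ∑ j, sBesovV P W s p r ℓ (W j)

/-- the paraproduct-type directional derivative `T_{W·∇} f := ∑_{q ∈ ℕ} S_{q-1}W · ∇Δ_q f` -/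
def paraD (P : LPData d) (W : Rd d → Rd d) (f : Rd d → ℂ) : Rd d → ℂ :=
  fun x => ∑' q : ℕ, ∑ i, P.low ((q : ℤ) - 1) (toC fun y => W y i) x * pd i (P.block (q : ℤ) f) x

/-- iterated paraproduct derivatives `(T_{W_1·∇})^{λ_1} ⋯ (T_{W_N·∇})^{λ_N} f` -/
def multiT (P : LPData d) {N : ℕ} (W : Fin N → Rd d → Rd d) (lam : Fin N → ℕ) (f : Rd d → ℂ) :
    Rd d → ℂ :=
  ((List.ofFn fun i : Fin N => (fun g : Rd d → ℂ => (paraD P (W i))^[lam i] g)).foldr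
    (· ∘ ·) id) f

/-- the paraproduct-striated Besov norm `‖f‖_{𝓑̃^{s,ℓ}_{p,r,𝒲}}` -/
def tBesov (P : LPData d) {N : ℕ} (W : Fin N → Rd d → Rd d) (s : ℝ) (p r : ℝ≥0∞) (ℓ : ℕ)
    (f : Rd d → ℂ) : ℝ≥0∞ :=
  ∑ lam ∈ Finset.univ.filter (fun lam : Fin N → Fin (ℓ + 1) => ∑ i, (lam i : ℕ) ≤ ℓ),
    besov P s p r (multiT P W (fun i => (lam i : ℕ)) f)

def tBesovR (P : LPData d) {N : ℕ} (W : Fin N → Rd d → Rd d) (s : ℝ) (p r : ℝ≥0∞) (ℓ : ℕ)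
    (f : Rd d → ℝ) : ℝ≥0∞ :=
  tBesov P W s p r ℓ (toC f)

def tBesovV (P : LPData d) {N : ℕ} (W : Fin N → Rd d → Rd d) (s : ℝ) (p r : ℝ≥0∞) (ℓ : ℕ)
    (u : Rd d → Rd d) : ℝ≥0∞ :=
  ∑ c, tBesovR P W s p r ℓ (fun x => u x c)

/-- the norm `‖𝒲‖_{𝓑̃^{s,ℓ}_{p,r,𝒲}}` of the family -/
def tBesovFam (P : LPData d) {N : ℕ} (W : Fin N → Rd d → Rd d) (s : ℝ) (p r : ℝ≥0∞) (ℓ : ℕ) :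
    ℝ≥0∞ :=
  ∑ j, tBesovV P W s p r ℓ (W j)

/-- `∑_i ‖∂_{W_i} f‖_{B^s_{p,r}}` -/
def dWBesov (P : LPData d) {N : ℕ} (W : Fin N → Rd d → Rd d) (s : ℝ) (p r : ℝ≥0∞)
    (f : Rd d → ℂ) : ℝ≥0∞ :=
  ∑ i, besov P s p r (dirD (W i) f)

/-- `∑_i ‖∂_{W_i} u‖_{B^s_{p,r}}` for a vector field -/
def dWBesovV (P : LPData d) {N : ℕ} (W : Fin N → Rd d → Rd d) (s : ℝ) (p r : ℝ≥0∞)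
    (u : Rd d → Rd d) : ℝ≥0∞ :=
  ∑ c, dWBesov P W s p r (toC fun x => u x c)

/-- `∑_i ‖∂_{W_i} ∇φ‖_{B^s_{p,r}}` -/
def dWBesovGrad (P : LPData d) {N : ℕ} (W : Fin N → Rd d → Rd d) (s : ℝ) (p r : ℝ≥0∞)
    (φ : Rd d → ℝ) : ℝ≥0∞ :=
  ∑ c, dWBesov P W s p r (toC fun x => pdR c φ x)

/-- `∑_i ‖T_{W_i·∇} f‖_{B^s_{p,r}}` -/
def TWBesov (P : LPData d) {N : ℕ} (W : Fin N → Rd d → Rd d) (s : ℝ) (p r : ℝ≥0∞)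
    (f : Rd d → ℂ) : ℝ≥0∞ :=
  ∑ i, besov P s p r (paraD P (W i) f)

/-- the Besov norm `‖𝒲‖_{B^s_{p,r}}` of a family of vector fields -/
def famB (P : LPData d) {N : ℕ} (W : Fin N → Rd d → Rd d) (s : ℝ) (p r : ℝ≥0∞) : ℝ≥0∞ :=
  ∑ j, besovV P s p r (W j)

/-! ### Pseudo-differential operators of order zero -/

/-- a zero order pseudo-differential operator `m(D)` with smooth symbol,
homogeneous of degree `0` -/
structure ZeroSymbol (d : ℕ) where
  m : Rd d → ℂ
  smooth : ContDiffOn ℝ (⊤ : ℕ∞) m {ξ : Rd d | ξ ≠ 0}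
  homog : ∀ c : ℝ, 0 < c → ∀ ξ : Rd d, m (c • ξ) = m ξ

/-- the operator `m(D)` -/
def mD (S : ZeroSymbol d) (f : Rd d → ℂ) : Rd d → ℂ := fm S.m f

/-- the commutator `[m(D), u·∇]φ` -/
def commMD (S : ZeroSymbol d) (u : Rd d → Rd d) (f : Rd d → ℂ) : Rd d → ℂ :=
  fun x => mD S (dirD u f) x - dirD u (mD S f) x

/-- the operator `𝓡_{-1} = m(D) Λ^{-1}`, `Λ = (-Δ)^{1/2}` being the Fourier multiplier with
symbol `|ξ|` -/
def Rminus1 (S : ZeroSymbol d) (f : Rd d → ℂ) : Rd d → ℂ :=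
  fm (fun ξ => S.m ξ * ((‖ξ‖ : ℂ))⁻¹) f

/-- the commutator `[𝓡_{-1}, u·∇]φ` -/
def commR (S : ZeroSymbol d) (u : Rd d → Rd d) (f : Rd d → ℂ) : Rd d → ℂ :=
  fun x => Rminus1 S (dirD u f) x - dirD u (Rminus1 S f) x

/-! ### norms involving gradients, Sobolev norms, time-space norms -/

/-- `‖∇u‖_{L^∞}` -/
def gradLinf (u : Rd d → Rd d) : ℝ≥0∞ := supNorm (fun x => fderiv ℝ u x)

/-- `‖∇u‖_{L^p}` -/
def gradLp (p : ℝ≥0∞) (u : Rd d → Rd d) : ℝ≥0∞ := eLpNorm (fun x => fderiv ℝ u x) p volume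

/-- `‖u‖_{W^{1,∞}} = ‖u‖_{L^∞} + ‖∇u‖_{L^∞}` -/
def W1inf (u : Rd d → Rd d) : ℝ≥0∞ := supNorm u + gradLinf u

/-- `‖u‖_{W^{1,p}} = ‖u‖_{L^p} + ‖∇u‖_{L^p}` -/
def sobW1p (p : ℝ≥0∞) (u : Rd d → Rd d) : ℝ≥0∞ := eLpNorm u p volume + gradLp p u

/-- the `H^1` norm of a vector field -/
def H1norm (u : Rd d → Rd d) : ℝ≥0∞ := sobW1p 2 u

/-- the `H^2` norm of a vector field -/
def H2norm (u : Rd d → Rd d) : ℝ≥0∞ :=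
  H1norm u + eLpNorm (fun x => fderiv ℝ (fun y => fderiv ℝ u y) x) 2 volume

/-- the norm of `L^ρ((0,t))` of a `ℝ≥0∞`-valued quantity -/
def timeLp (ρ : ℝ≥0∞) (t : ℝ) (g : ℝ → ℝ≥0∞) : ℝ≥0∞ :=
  if ρ = ⊤ then ⨆ τ : Ioc (0 : ℝ) t, g τ
  else (∫⁻ τ in Ioc (0 : ℝ) t, g τ ^ ρ.toReal) ^ (1 / ρ.toReal)

/-- the Chemin–Lerner norm `‖f‖_{L̃^ρ_t(B^s_{p,r})}` -/
def clNorm (P : LPData d) (s : ℝ) (p r ρ : ℝ≥0∞) (t : ℝ) (f : ℝ → Rd d → ℝ) : ℝ≥0∞ :=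
  seqLr r (fun q => if -1 ≤ q then
    dyadic s q * timeLp ρ t (fun τ => eLpNorm (P.block q (toC (f τ))) p volume) else 0)

/-! ### flows -/

/-- particle trajectory map of a (time dependent) velocity field. -/
def IsFlow (u X : ℝ → Rd d → Rd d) : Prop :=
  ∀ t ∈ Ici (0 : ℝ), ∀ x, X t x = x + ∫ τ in (0 : ℝ)..t, u τ (X τ x)

/-- a flow map together with its inverse -/
structure FlowPair (u X Xi : ℝ → Rd d → Rd d) : Prop where
  flow : IsFlow u X
  left : ∀ t ∈ Ici (0 : ℝ), Function.LeftInverse (Xi t) (X t)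
  right : ∀ t ∈ Ici (0 : ℝ), Function.RightInverse (Xi t) (X t)

/-! ### the 2D viscous Boussinesq system (weak formulation) -/

/-- scalar test functions on `ℝ × ℝ²` -/
def TestS (ψ : ℝ × Rd 2 → ℝ) : Prop :=
  ContDiff ℝ (⊤ : ℕ∞) ψ ∧ HasCompactSupport ψ

/-- divergence-free vector test functions on `ℝ × ℝ²` -/
def TestV (Φ : ℝ × Rd 2 → Rd 2) : Prop :=
  ContDiff ℝ (⊤ : ℕ∞) Φ ∧ HasCompactSupport Φ ∧
    ∀ (t : ℝ) (x : Rd 2), ∑ i, pdR i (fun y => Φ (t, y) i) x = 0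

/-- a (locally integrable) vector field is divergence free in the sense of distributions -/
def WeakDivFree (v : Rd d → Rd d) : Prop :=
  ∀ ψ : Rd d → ℝ, ContDiff ℝ (⊤ : ℕ∞) ψ → HasCompactSupport ψ →
    (∫ x, ∑ i, v x i * pdR i ψ x) = 0

/-- time derivative of a test function -/
def dtP (ψ : ℝ × Rd 2 → ℝ) (t : ℝ) (x : Rd 2) : ℝ :=
  fderiv ℝ ψ (t, x) ((1 : ℝ), (0 : Rd 2))

/-- spatial partial derivative of a test function -/
def dxP (i : Fin 2) (ψ : ℝ × Rd 2 → ℝ) (t : ℝ) (x : Rd 2) : ℝ :=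
  fderiv ℝ ψ (t, x) ((0 : ℝ), e 2 i)

/-- the temperature equation `∂_t θ + u·∇θ = 0`, `θ(0) = θ₀`, in the weak sense -/
def WeakTransport (u : ℝ → Rd 2 → Rd 2) (θ₀ : Rd 2 → ℝ) (θ : ℝ → Rd 2 → ℝ) : Prop :=
  ∀ ψ : ℝ × Rd 2 → ℝ, TestS ψ →
    ((∫ t in Ioi (0 : ℝ), ∫ x, θ t x * (dtP ψ t x + ∑ i, u t x i * dxP i ψ t x)) +
      ∫ x, θ₀ x * ψ (0, x)) = 0

/-- the momentum equation `∂_t u + u·∇u - Δu + ∇p = θ e₂`, `u(0) = u₀`, in the weak sense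
(tested against divergence free test fields, which eliminates the pressure) -/
def WeakMomentum (θ : ℝ → Rd 2 → ℝ) (u₀ : Rd 2 → Rd 2) (u : ℝ → Rd 2 → Rd 2) : Prop :=
  ∀ Φ : ℝ × Rd 2 → Rd 2, TestV Φ →
    ((∫ t in Ioi (0 : ℝ), ∫ x,
        ((∑ i, u t x i * fderiv ℝ (fun q => Φ q i) (t, x) ((1 : ℝ), (0 : Rd 2)))
          + (∑ j, ∑ i, u t x j * u t x i * fderiv ℝ (fun q => Φ q i) (t, x) ((0 : ℝ), e 2 j))
          + (∑ i, u t x i *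
              ∑ j, fderiv ℝ (fun z => fderiv ℝ (fun q => Φ q i) z ((0 : ℝ), e 2 j)) (t, x)
                ((0 : ℝ), e 2 j))
          + θ t x * Φ (t, x) 1)) +
      ∫ x, ∑ i, u₀ x i * Φ (0, x) i) = 0

/-- a global weak solution of the 2D viscous Boussinesq system (viscosity `ν = 1`,
no heat diffusion) with data `(θ₀, u₀)` -/
structure IsBoussinesq (θ₀ : Rd 2 → ℝ) (u₀ : Rd 2 → Rd 2)
    (θ : ℝ → Rd 2 → ℝ) (u : ℝ → Rd 2 → Rd 2) : Prop where
  transport : WeakTransport u θ₀ θ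
  momentum : WeakMomentum θ u₀ u
  divfree : ∀ t, 0 < t → WeakDivFree (u t)

/-- the regularity class `u ∈ C([0,T];H¹) ∩ L²(0,T;H²) ∩ L¹(0,T;C^{1,γ'}) (∀ γ' ∈ (0,1))`
in which existence and uniqueness holds -/
def RegClass (T : ℝ) (u : ℝ → Rd 2 → Rd 2) : Prop :=
  (∀ t ∈ Icc (0 : ℝ) T, H1norm (u t) < ⊤) ∧
  (∀ t ∈ Icc (0 : ℝ) T,
    Tendsto (fun s => H1norm (fun x => u s x - u t x)) (𝓝[Icc (0 : ℝ) T] t) (𝓝 0)) ∧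
  timeLp 2 T (fun t => H2norm (u t)) < ⊤ ∧
  ∀ γ' : ℝ, γ' ∈ Ioo (0 : ℝ) 1 → timeLp 1 T (fun t => ckγ 1 γ' (u t)) < ⊤

/-! ### patches and level sets -/

/-- a bounded simply connected (open, nonempty) domain -/
structure NiceDomain (D : Set (Rd 2)) : Prop where
  isOpen : IsOpen D
  bounded : Bornology.IsBounded D
  nonempty : D.Nonempty
  simplyConnected : SimplyConnectedSpace D

/-- `φ` is a level-set characterization of the domain `D`:
`∂D = {φ = 0}`, `D = {φ > 0}` and `∇φ ≠ 0` on `∂D`. -/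
structure IsLevelSet (D : Set (Rd 2)) (φ : Rd 2 → ℝ) : Prop where
  zero : frontier D = {x | φ x = 0}
  pos : D = {x | 0 < φ x}
  grad_ne : ∀ x ∈ frontier D, gradV φ x ≠ 0

/-- the perpendicular gradient `∇^⊥φ = (-∂₂φ, ∂₁φ)` -/
def perpGrad (φ : Rd 2 → ℝ) (x : Rd 2) : Rd 2 :=
  (EuclideanSpace.equiv (Fin 2) ℝ).symm
    (fun i => if i = 0 then -pdR 1 φ x else pdR 0 φ x)

/-- the `q`-th dyadic block of the distribution `∂_W^n θ = (div (W ·))^n θ`, `div W = 0`: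
since `∂_W` has transpose `-W·∇`, it is obtained by pairing `θ` with the `n`-fold directional
derivative of the translated convolution kernel of `Δ_q`. -/
def blockDirPow (P : LPData d) (W : Rd d → Rd d) (n : ℕ) (θ : Rd d → ℝ) (q : ℤ) (x : Rd d) :
    ℂ :=
  (-1 : ℂ) ^ n *
    ∫ y, (θ y : ℂ) *
      (dirD W)^[n] (fun z => 𝓕⁻ (fun ξ => ((P.symb q ξ : ℝ) : ℂ)) (x - z)) y

end Paper

namespace StriAux
open Paper

/-- Finite-order Hölder regularity on a set, phrased with iterated partial derivatives. -/
def A (B : Set (Rd 2)) (γ : ℝ) : ℕ → (Rd 2 → ℂ) → Prop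
  | 0, f => Continuous f ∧ ∃ C : ℝ, 0 ≤ C ∧ ∀ x ∈ B, ∀ y ∈ B, ‖f x - f y‖ ≤ C * ‖x - y‖ ^ γ
  | m + 1, f => ContDiff ℝ 1 f ∧ ∀ i, A B γ m (pd i f)

lemma A_cont {B : Set (Rd 2)} {γ : ℝ} {m : ℕ} {f : Rd 2 → ℂ} (h : A B γ m f) : Continuous f := by
  cases m with
  | zero => exact h.1
  | succ m => exact h.1.continuous

lemma pd_cont {f : Rd 2 → ℂ} (h : ContDiff ℝ 1 f) (i : Fin 2) : Continuous (pd i f) := by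
  unfold pd
  exact (h.continuous_fderiv (by norm_num)).clm_apply continuous_const

lemma holder_of_C1 {R γ : ℝ} (hγ : γ ∈ Set.Ioo (0:ℝ) 1) (hR : 0 ≤ R)
    {f : Rd 2 → ℂ} (h : ContDiff ℝ 1 f) :
    ∃ C : ℝ, 0 ≤ C ∧ ∀ x ∈ Metric.closedBall (0 : Rd 2) R, ∀ y ∈ Metric.closedBall (0 : Rd 2) R,
      ‖f x - f y‖ ≤ C * ‖x - y‖ ^ γ := by
  obtain ⟨C, hC⟩ := (isCompact_closedBall (0 : Rd 2) R).exists_bound_of_continuousOn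
    (h.continuous_fderiv (by norm_num)).continuousOn
  have hC0 : 0 ≤ C := le_trans (norm_nonneg _) (hC 0 (by simpa using hR))
  refine ⟨C * (2 * R) ^ (1 - γ), by positivity, fun x hx y hy => ?_⟩
  have h1 := (convex_closedBall (0 : Rd 2) R).norm_image_sub_le_of_norm_fderiv_le (𝕜 := ℝ)
    (f := f) (fun z _ => h.differentiable (by norm_num) z) hC hy hx
  have h2 : ‖x - y‖ ≤ 2 * R := by
    have := norm_sub_le x y
    simp only [mem_closedBall_zero_iff] at hx hy
    linarith
  have h3 : ‖x - y‖ = ‖x - y‖ ^ (1 - γ) * ‖x - y‖ ^ γ := by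
    rw [← Real.rpow_add_of_nonneg (norm_nonneg _) (by linarith [hγ.2]) hγ.1.le]; simp
  have h4 : ‖x - y‖ ^ (1 - γ) ≤ (2 * R) ^ (1 - γ) :=
    Real.rpow_le_rpow (norm_nonneg _) h2 (by linarith [hγ.2])
  calc ‖f x - f y‖ ≤ C * ‖x - y‖ := h1
    _ = C * (‖x - y‖ ^ (1 - γ) * ‖x - y‖ ^ γ) := by rw [← h3]
    _ ≤ C * ((2 * R) ^ (1 - γ) * ‖x - y‖ ^ γ) := by gcongr
    _ = _ := by ring

lemma A_pred {R γ : ℝ} (hγ : γ ∈ Set.Ioo (0:ℝ) 1) (hR : 0 ≤ R) {m : ℕ} {f : Rd 2 → ℂ}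
    (h : A (Metric.closedBall 0 R) γ (m + 1) f) : A (Metric.closedBall 0 R) γ m f := by
  induction m generalizing f with
  | zero => exact ⟨h.1.continuous, holder_of_C1 hγ hR h.1⟩
  | succ m ih => exact ⟨h.1, fun i => ih (h.2 i)⟩

lemma A_le {R γ : ℝ} (hγ : γ ∈ Set.Ioo (0:ℝ) 1) (hR : 0 ≤ R) {m n : ℕ} (hmn : m ≤ n)
    {f : Rd 2 → ℂ}
    (h : A (Metric.closedBall 0 R) γ n f) : A (Metric.closedBall 0 R) γ m f := by
  induction n, hmn using Nat.le_induction with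
  | base => exact h
  | succ n _ ih => exact ih (A_pred hγ hR h)

lemma A_add {B : Set (Rd 2)} {γ : ℝ} {m : ℕ} {f g : Rd 2 → ℂ}
    (hf : A B γ m f) (hg : A B γ m g) : A B γ m (fun x => f x + g x) := by
  induction m generalizing f g with
  | zero =>
    obtain ⟨hf, C, hC, hC'⟩ := hf
    obtain ⟨hg, C1, hC1, hC1'⟩ := hg
    refine ⟨hf.add hg, C + C1, by positivity, fun x hx y hy => ?_⟩
    have h1 := hC' x hx y hy
    have h2 := hC1' x hx y hy
    calc ‖f x + g x - (f y + g y)‖ = ‖(f x - f y) + (g x - g y)‖ := by congr 1; ring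
      _ ≤ _ := norm_add_le _ _
      _ ≤ _ := by linarith
  | succ m ih =>
    refine ⟨hf.1.add hg.1, fun i => ?_⟩
    have : pd i (fun x => f x + g x) = fun x => pd i f x + pd i g x := by
      funext x
      unfold pd
      rw [fderiv_fun_add (hf.1.differentiable (by norm_num) x)
        (hg.1.differentiable (by norm_num) x)]
      rfl
    rw [this]
    exact ih (hf.2 i) (hg.2 i)

lemma pd_mul {f g : Rd 2 → ℂ} (hf : ContDiff ℝ 1 f) (hg : ContDiff ℝ 1 g) (i : Fin 2) :
    pd i (fun x => f x * g x) = fun x => f x * pd i g x + pd i f x * g x := by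
  funext x
  unfold pd
  rw [fderiv_fun_mul (hf.differentiable (by norm_num) x)
        (hg.differentiable (by norm_num) x)]
  simp [mul_comm]

lemma A_mul {R γ : ℝ} (hγ : γ ∈ Set.Ioo (0:ℝ) 1) (hR : 0 ≤ R) {m : ℕ} {f g : Rd 2 → ℂ}
    (hf : A (Metric.closedBall 0 R) γ m f) (hg : A (Metric.closedBall 0 R) γ m g) :
    A (Metric.closedBall 0 R) γ m (fun x => f x * g x) := by
  induction m generalizing f g with
  | zero =>
    obtain ⟨hf, C, hC, hC'⟩ := hf
    obtain ⟨hg, C1, hC1, hC1'⟩ := hg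
    obtain ⟨M, hM⟩ := (isCompact_closedBall (0 : Rd 2) R).exists_bound_of_continuousOn
      hf.continuousOn
    obtain ⟨N, hN⟩ := (isCompact_closedBall (0 : Rd 2) R).exists_bound_of_continuousOn
      hg.continuousOn
    have hM0 : 0 ≤ M := le_trans (norm_nonneg _) (hM 0 (by simpa using hR))
    have hN0 : 0 ≤ N := le_trans (norm_nonneg _) (hN 0 (by simpa using hR))
    refine ⟨hf.mul hg, M * C1 + C * N, by positivity, fun x hx y hy => ?_⟩
    have h1 := hC' x hx y hy
    have h2 := hC1' x hx y hy
    calc ‖f x * g x - f y * g y‖ = ‖f x * (g x - g y) + (f x - f y) * g y‖ := by congr 1; ring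
      _ ≤ ‖f x‖ * ‖g x - g y‖ + ‖f x - f y‖ * ‖g y‖ := by
        rw [← norm_mul, ← norm_mul]; exact norm_add_le _ _
      _ ≤ M * (C1 * ‖x - y‖ ^ γ) + (C * ‖x - y‖ ^ γ) * N := by
        gcongr
        exacts [hM x hx, hN y hy]
      _ = _ := by ring
  | succ m ih =>
    refine ⟨hf.1.mul hg.1, fun i => ?_⟩
    rw [pd_mul hf.1 hg.1]
    exact A_add (ih (A_pred hγ hR hf) (hg.2 i)) (ih (hf.2 i) (A_pred hγ hR hg))

lemma A_dirD {R γ : ℝ} (hγ : γ ∈ Set.Ioo (0:ℝ) 1) (hR : 0 ≤ R) {m : ℕ} {f : Rd 2 → ℂ}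
    {W : Rd 2 → Rd 2} (hW : ∀ i, A (Metric.closedBall 0 R) γ m (fun x => ((W x i : ℝ) : ℂ)))
    (hf : A (Metric.closedBall 0 R) γ (m + 1) f) :
    A (Metric.closedBall 0 R) γ m (dirD W f) := by
  have : dirD W f = fun x => ((W x 0 : ℝ) : ℂ) * pd 0 f x + ((W x 1 : ℝ) : ℂ) * pd 1 f x := by
    funext x; simp [dirD, Fin.sum_univ_two]
  rw [this]
  exact A_add (A_mul hγ hR (hW 0) (hf.2 0)) (A_mul hγ hR (hW 1) (hf.2 1))

lemma A_iter {R γ : ℝ} (hγ : γ ∈ Set.Ioo (0:ℝ) 1) (hR : 0 ≤ R) {N : ℕ} {f : Rd 2 → ℂ}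
    {W : Rd 2 → Rd 2} (hW : ∀ i, A (Metric.closedBall 0 R) γ N (fun x => ((W x i : ℝ) : ℂ)))
    (j m : ℕ) (hm : m ≤ N)
    (hf : A (Metric.closedBall 0 R) γ (m + j) f) (hj : m + j ≤ N + 1) :
    A (Metric.closedBall 0 R) γ m ((dirD W)^[j] f) := by
  induction j generalizing m with
  | zero => exact hf
  | succ j ih =>
    rw [Function.iterate_succ_apply']
    refine A_dirD hγ hR (fun i => A_le hγ hR hm (hW i)) ?_
    by_cases h : m + 1 ≤ N
    · exact ih (m + 1) h (by rwa [show m + 1 + j = m + (j + 1) by omega]) (by omega)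
    · have : j = 0 := by omega
      subst this
      exact hf

/-- `C^m` with globally Hölder `m`-th derivative. -/
def Hm (γ : ℝ) (m : ℕ) {F : Type} [NormedAddCommGroup F] [NormedSpace ℝ F] (f : Rd 2 → F) : Prop :=
  ContDiff ℝ m f ∧ ∃ C : ℝ, 0 ≤ C ∧ ∀ x y,
    ‖iteratedFDeriv ℝ m f x - iteratedFDeriv ℝ m f y‖ ≤ C * ‖x - y‖ ^ γ

lemma Hm_of_mem {γ : ℝ} (hγ : 0 < γ) {m : ℕ} {f : Rd 2 → ℝ} (h : MemCkγ m γ f) : Hm γ m f := by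
  obtain ⟨h1, h2⟩ := h
  refine ⟨h1, (hSemi γ (iteratedFDeriv ℝ m f)).toReal, by positivity, fun x y => ?_⟩
  have h3 : hSemi γ (iteratedFDeriv ℝ m f) < ⊤ := lt_of_le_of_lt (by unfold ckγ; exact le_add_self) h2
  by_cases hxy : x = y
  · subst hxy; simp; positivity
  have h4 : (‖iteratedFDeriv ℝ m f x - iteratedFDeriv ℝ m f y‖₊ : ℝ≥0∞) / (edist x y) ^ γ ≤
      hSemi γ (iteratedFDeriv ℝ m f) := by
    unfold hSemi
    exact le_iSup₂_of_le x y le_rfl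
  have h5 : (edist x y) ^ γ ≠ 0 := by
    simp [ENNReal.rpow_eq_zero_iff, hγ, hxy, edist_ne_top]
  have h6 : (edist x y) ^ γ ≠ ⊤ := ENNReal.rpow_ne_top_of_nonneg hγ.le (edist_ne_top _ _)
  rw [ENNReal.div_le_iff h5 h6] at h4
  have h7 := ENNReal.toReal_mono (ENNReal.mul_ne_top h3.ne h6) h4
  rw [ENNReal.toReal_mul, ← ENNReal.toReal_rpow] at h7
  rw [edist_dist, ENNReal.toReal_ofReal dist_nonneg, dist_eq_norm] at h7
  simpa using h7

lemma Hm_clm {γ : ℝ} {m : ℕ} {F G : Type} [NormedAddCommGroup F] [NormedSpace ℝ F]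
    [NormedAddCommGroup G] [NormedSpace ℝ G] (L : F →L[ℝ] G) {f : Rd 2 → F} (h : Hm γ m f) :
    Hm γ m (fun x => L (f x)) := by
  obtain ⟨h1, C, hC, h2⟩ := h
  refine ⟨L.contDiff.comp h1, ‖L‖ * C, by positivity, fun x y => ?_⟩
  have e1 : ∀ x, iteratedFDeriv ℝ m (fun x => L (f x)) x =
      L.compContinuousMultilinearMap (iteratedFDeriv ℝ m f x) := fun x =>
    L.iteratedFDeriv_comp_left h1.contDiffAt le_rfl
  have e2 : L.compContinuousMultilinearMap (iteratedFDeriv ℝ m f x) -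
      L.compContinuousMultilinearMap (iteratedFDeriv ℝ m f y) =
      L.compContinuousMultilinearMap (iteratedFDeriv ℝ m f x - iteratedFDeriv ℝ m f y) := by
    ext v; simp
  rw [e1, e1, e2]
  calc _ ≤ ‖L‖ * ‖iteratedFDeriv ℝ m f x - iteratedFDeriv ℝ m f y‖ :=
        L.norm_compContinuousMultilinearMap_le _
    _ ≤ ‖L‖ * (C * ‖x - y‖ ^ γ) := by gcongr; exact h2 x y
    _ = _ := by ring

lemma Hm_fderiv {γ : ℝ} {m : ℕ} {f : Rd 2 → ℂ} (h : Hm γ (m + 1) f) :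
    Hm γ m (fderiv ℝ f) := by
  obtain ⟨h1, C, hC, h2⟩ := h
  refine ⟨h1.fderiv_right (by norm_cast), C, hC, fun x y => ?_⟩
  have := h2 x y
  rw [iteratedFDeriv_succ_eq_comp_right, iteratedFDeriv_succ_eq_comp_right] at this
  have h3 := (continuousMultilinearCurryRightEquiv' ℝ m (Rd 2) ℂ).symm.dist_map
    (iteratedFDeriv ℝ m (fderiv ℝ f) x) (iteratedFDeriv ℝ m (fderiv ℝ f) y)
  rw [← dist_eq_norm, ← h3, dist_eq_norm]
  exact this

lemma A_of_Hm (B : Set (Rd 2)) {γ : ℝ} {m : ℕ} {f : Rd 2 → ℂ} (h : Hm γ m f) : A B γ m f := by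
  induction m generalizing f with
  | zero =>
    obtain ⟨h1, C, hC, h2⟩ := h
    refine ⟨h1.continuous, C, hC, fun x _ y _ => ?_⟩
    have := h2 x y
    rw [iteratedFDeriv_zero_eq_comp] at this
    simp only [Function.comp] at this
    rw [← map_sub, LinearIsometryEquiv.norm_map] at this
    exact this
  | succ m ih =>
    refine ⟨h.1.of_le (by norm_cast; omega), fun i => ih ?_⟩
    exact Hm_clm (ContinuousLinearMap.apply ℝ ℂ (e 2 i)) (Hm_fderiv h)

lemma A_of_mem (B : Set (Rd 2)) {γ : ℝ} (hγ : 0 < γ) {m : ℕ} {f : Rd 2 → ℝ} (h : MemCkγ m γ f) :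
    A B γ m (toC f) :=
  A_of_Hm B (Hm_clm Complex.ofRealCLM (Hm_of_mem hγ h))

lemma A_smooth {R γ : ℝ} (hγ : γ ∈ Set.Ioo (0:ℝ) 1) (hR : 0 ≤ R) (m : ℕ) {f : Rd 2 → ℂ}
    (h : ContDiff ℝ (m + 1 : ℕ) f) : A (Metric.closedBall 0 R) γ m f := by
  induction m generalizing f with
  | zero => exact ⟨h.continuous, holder_of_C1 hγ hR (by simpa using h)⟩
  | succ m ih =>
    refine ⟨h.of_le (by norm_cast; omega), fun i => ih ?_⟩
    unfold pd
    exact (h.fderiv_right (by norm_cast)).clm_apply contDiff_const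

lemma pd_toC {f : Rd 2 → ℝ} (h : ContDiff ℝ 1 f) (i : Fin 2) :
    pd i (toC f) = fun x => ((pdR i f x : ℝ) : ℂ) := by
  funext x
  unfold pd toC pdR
  have := (Complex.ofRealCLM.hasFDerivAt (x := f x)).comp x
    (h.differentiable (by norm_num) x).hasFDerivAt
  have h2 := this.fderiv
  have h3 : (Complex.ofRealCLM : ℝ → ℂ) ∘ f = fun x => (f x : ℂ) := rfl
  rw [h3] at h2
  rw [h2]; rfl

lemma A_W {R γ : ℝ} (hγ : γ ∈ Set.Ioo (0:ℝ) 1) (hR : 0 ≤ R) {m : ℕ} {φ : Rd 2 → ℝ}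
    (h : MemCkγ (m + 1) γ φ) (i : Fin 2) :
    A (Metric.closedBall 0 R) γ m (fun x => ((perpGrad φ x i : ℝ) : ℂ)) := by
  have h1 := A_of_mem (Metric.closedBall 0 R) hγ.1 h
  have hc : ContDiff ℝ 1 φ := h.1.of_le (by norm_cast; omega)
  have h2 : ∀ j, A (Metric.closedBall 0 R) γ m (fun x => ((pdR j φ x : ℝ) : ℂ)) := fun j => by
    rw [← pd_toC hc]; exact h1.2 j
  fin_cases i
  · have h3 := A_mul hγ hR (A_smooth hγ hR m (f := fun _ => (-1 : ℂ)) contDiff_const) (h2 1)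
    simpa [perpGrad] using h3
  · simpa [perpGrad] using h2 0

lemma two_le_aux (m : ℕ) : (2 : WithTop ℕ∞) ≤ (((m + 2 : ℕ) : ℕ∞) : WithTop ℕ∞) := by
  have h : (2 : ℕ∞) ≤ ((m + 2 : ℕ) : ℕ∞) := by
    have := (Nat.cast_le (α := ℕ∞)).2 (Nat.le_add_left 2 m)
    exact this
  exact WithTop.coe_le_coe.2 h

lemma curl_zero {H u : Rd 2 → ℂ} (hH : ContDiff ℝ 2 H) (hs : HasCompactSupport H)
    (hu : ContDiff ℝ 1 u) :
    ∫ x, (pd 0 H x * pd 1 u x - pd 1 H x * pd 0 u x) = 0 := by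
  have hp : ∀ i, ContDiff ℝ 1 (pd i H) := fun i => by
    unfold pd
    exact (hH.fderiv_right (by norm_num)).clm_apply contDiff_const
  have hsp : ∀ i, HasCompactSupport (pd i H) := fun i => hs.fderiv_apply (𝕜 := ℝ) (e 2 i)
  have hspp : ∀ i j, HasCompactSupport (pd j (pd i H)) :=
    fun i j => (hsp i).fderiv_apply (𝕜 := ℝ) (e 2 j)
  have I1 : ∀ i j, Integrable (fun x => pd i H x * pd j u x) := fun i j =>
    ((hp i).continuous.mul (pd_cont hu j)).integrable_of_hasCompactSupport ((hsp i).mul_right)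
  have I2 : ∀ i j, Integrable (fun x => pd j (pd i H) x * u x) := fun i j =>
    ((pd_cont (hp i) j).mul hu.continuous).integrable_of_hasCompactSupport ((hspp i j).mul_right)
  have I3 : ∀ i, Integrable (fun x => pd i H x * u x) := fun i =>
    ((hp i).continuous.mul hu.continuous).integrable_of_hasCompactSupport ((hsp i).mul_right)
  have ibp : ∀ i j, ∫ x, pd i H x * pd j u x = - ∫ x, pd j (pd i H) x * u x := fun i j =>
    integral_mul_fderiv_eq_neg_fderiv_mul_of_integrable (I2 i j) (I1 i j) (I3 i)
      (fun x _ => (hp i).differentiable (by norm_num) x)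
      (fun x _ => hu.differentiable (by norm_num) x)
  have sym : ∀ x, pd 1 (pd 0 H) x = pd 0 (pd 1 H) x := fun x => by
    have h1 : ∀ i j, pd j (pd i H) x = fderiv ℝ (fderiv ℝ H) x (e 2 j) (e 2 i) := fun i j => by
      unfold pd
      have hd : DifferentiableAt ℝ (fderiv ℝ H) x :=
        (hH.fderiv_right (m := 1) (by norm_num)).differentiable (by norm_num) x
      rw [fderiv_clm_apply hd (differentiableAt_const _)]
      simp
    rw [h1, h1]
    exact (hH.contDiffAt.isSymmSndFDerivAt (by simp)) _ _
  rw [integral_sub (I1 0 1) (I1 1 0), ibp, ibp]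
  simp [sym]

/-- a primitive of a smooth step -/
def Phi (n : ℕ) (t : ℝ) : ℝ := ∫ s in (0:ℝ)..t, Real.smoothTransition (n * s)

lemma Phi_deriv (n : ℕ) (t : ℝ) : HasDerivAt (Phi n) (Real.smoothTransition (n * t)) t := by
  have hc : Continuous (fun s : ℝ => Real.smoothTransition (n * s)) :=
    Real.smoothTransition.continuous.comp (continuous_const.mul continuous_id)
  exact intervalIntegral.integral_hasDerivAt_right (hc.intervalIntegrable _ _)
    (hc.stronglyMeasurableAtFilter _ _) hc.continuousAt

lemma Phi_contDiff (n : ℕ) : ContDiff ℝ 2 (Phi n) := by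
  have hd : deriv (Phi n) = fun t => Real.smoothTransition (n * t) :=
    funext fun t => (Phi_deriv n t).deriv
  rw [show (2 : WithTop ℕ∞) = 1 + 1 by norm_num, contDiff_succ_iff_deriv]
  refine ⟨fun t => (Phi_deriv n t).differentiableAt, by simp, ?_⟩
  rw [hd]
  exact (Real.smoothTransition.contDiff (n := 1)).comp (contDiff_const.mul contDiff_id)

lemma Phi_zero (n : ℕ) {t : ℝ} (ht : t ≤ 0) : Phi n t = 0 := by
  unfold Phi
  rw [intervalIntegral.integral_congr (g := fun _ => (0:ℝ))]
  · simp
  · intro s hs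
    rw [Set.uIcc_of_ge ht] at hs
    exact Real.smoothTransition.zero_of_nonpos
      (mul_nonpos_of_nonneg_of_nonpos (Nat.cast_nonneg n) hs.2)

lemma dirD_eq (φ : Rd 2 → ℝ) (u : Rd 2 → ℂ) (x : Rd 2) :
    dirD (perpGrad φ) u x = (pdR 0 φ x : ℂ) * pd 1 u x - (pdR 1 φ x : ℂ) * pd 0 u x := by
  simp [dirD, Fin.sum_univ_two, perpGrad]; ring

lemma pdR_cont {φ : Rd 2 → ℝ} (h : ContDiff ℝ 1 φ) (i : Fin 2) : Continuous (pdR i φ) := by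
  unfold pdR
  exact (h.continuous_fderiv (by norm_num)).clm_apply continuous_const

lemma dirD_cont {φ : Rd 2 → ℝ} {u : Rd 2 → ℂ} (hφ : ContDiff ℝ 1 φ) (hu : ContDiff ℝ 1 u) :
    Continuous (dirD (perpGrad φ) u) := by
  rw [funext (dirD_eq φ u)]
  exact ((Complex.continuous_ofReal.comp (pdR_cont hφ 0)).mul (pd_cont hu 1)).sub
    ((Complex.continuous_ofReal.comp (pdR_cont hφ 1)).mul (pd_cont hu 0))

lemma intOn {D : Set (Rd 2)} (hb : Bornology.IsBounded D) {f : Rd 2 → ℂ} (hf : Continuous f) :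
    IntegrableOn f D :=
  (hf.continuousOn.integrableOn_compact hb.isCompact_closure).mono_set subset_closure

lemma int_dirD_zero {D : Set (Rd 2)} {φ : Rd 2 → ℝ} (hb : Bornology.IsBounded D)
    (hD : D = {x | 0 < φ x}) (hφ : ContDiff ℝ 2 φ) {u : Rd 2 → ℂ} (hu : ContDiff ℝ 1 u) :
    ∫ x in D, dirD (perpGrad φ) u x = 0 := by
  have hφ1 : ContDiff ℝ 1 φ := hφ.of_le (by norm_num)
  have hm : MeasurableSet D := by
    rw [hD]; exact (isOpen_lt continuous_const hφ.continuous).measurableSet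
  have hc := dirD_cont hφ1 hu
  have key : ∀ n : ℕ, ∫ x in D, (Real.smoothTransition (n * φ x) : ℂ) * dirD (perpGrad φ) u x = 0 := by
    intro n
    have hH : ContDiff ℝ 2 (fun x => Phi n (φ x)) := (Phi_contDiff n).comp hφ
    have hHC : ContDiff ℝ 2 (toC fun x => Phi n (φ x)) := Complex.ofRealCLM.contDiff.comp hH
    have hs : HasCompactSupport (toC fun x => Phi n (φ x)) := by
      refine HasCompactSupport.intro hb.isCompact_closure (fun x hx => ?_)
      have : ¬ 0 < φ x := fun h => hx (subset_closure (by rw [hD]; exact h))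
      simp [toC, Phi_zero n (not_lt.1 this)]
    have h0 := curl_zero hHC hs hu
    have hp : ∀ i x, pd i (toC fun x => Phi n (φ x)) x =
        (Real.smoothTransition (n * φ x) : ℂ) * (pdR i φ x : ℂ) := fun i x => by
      rw [pd_toC (hH.of_le (by norm_num))]
      unfold pdR
      have := ((Phi_deriv n (φ x)).comp_hasFDerivAt x
        (hφ1.differentiable (by norm_num) x).hasFDerivAt).fderiv
      have h3 : (Phi n) ∘ φ = fun x => Phi n (φ x) := rfl
      rw [h3] at this
      simp [this]
    rw [← h0, ← integral_indicator hm]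
    congr 1
    funext x
    rw [hp, hp]
    by_cases hx : x ∈ D
    · rw [Set.indicator_of_mem hx, dirD_eq]; ring
    · rw [Set.indicator_of_notMem hx, Real.smoothTransition.zero_of_nonpos]
      · simp
      · have : ¬ 0 < φ x := fun h => hx (by rw [hD]; exact h)
        exact mul_nonpos_of_nonneg_of_nonpos (Nat.cast_nonneg n) (not_lt.1 this)
  have hlim : Tendsto (fun n : ℕ => ∫ x in D,
      (Real.smoothTransition (n * φ x) : ℂ) * dirD (perpGrad φ) u x) atTop
      (𝓝 (∫ x in D, dirD (perpGrad φ) u x)) := by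
    refine tendsto_integral_of_dominated_convergence (fun x => ‖dirD (perpGrad φ) u x‖)
      (fun n => ?_) (intOn hb hc).norm (fun n => ?_) ?_
    · refine Continuous.aestronglyMeasurable ?_
      exact (Complex.continuous_ofReal.comp (Real.smoothTransition.continuous.comp
        (continuous_const.mul hφ.continuous))).mul hc
    · refine Eventually.of_forall fun x => ?_
      rw [norm_mul, Complex.norm_real, Real.norm_of_nonneg (Real.smoothTransition.nonneg _)]
      exact mul_le_of_le_one_left (norm_nonneg _) (Real.smoothTransition.le_one _)
    · refine (ae_restrict_iff' hm).2 (Eventually.of_forall fun x hx => ?_)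
      rw [hD] at hx
      have hx' : 0 < φ x := hx
      refine tendsto_const_nhds.congr' ?_
      obtain ⟨N, hN⟩ := exists_nat_gt (1 / φ x)
      filter_upwards [eventually_ge_atTop N] with n hn
      rw [Real.smoothTransition.one_of_one_le]
      · simp
      · have h1 : (N : ℝ) ≤ n := by exact_mod_cast hn
        rw [div_lt_iff₀ hx'] at hN
        nlinarith
  simp only [key] at hlim
  exact (tendsto_nhds_unique hlim tendsto_const_nhds)

lemma ibp_D {D : Set (Rd 2)} {φ : Rd 2 → ℝ} (hb : Bornology.IsBounded D)
    (hD : D = {x | 0 < φ x}) (hφ : ContDiff ℝ 2 φ) {f u : Rd 2 → ℂ} (hf : ContDiff ℝ 1 f)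
    (hu : ContDiff ℝ 1 u) :
    ∫ x in D, f x * dirD (perpGrad φ) u x = - ∫ x in D, dirD (perpGrad φ) f x * u x := by
  have hφ1 : ContDiff ℝ 1 φ := hφ.of_le (by norm_num)
  have h0 := int_dirD_zero hb hD hφ (hf.mul hu)
  have h1 : dirD (perpGrad φ) (fun x => f x * u x) = fun x =>
      f x * dirD (perpGrad φ) u x + dirD (perpGrad φ) f x * u x := by
    funext x
    rw [dirD_eq, dirD_eq, dirD_eq, pd_mul hf hu, pd_mul hf hu]; ring
  rw [h1] at h0
  have h2 := integral_add (intOn hb (hf.continuous.mul (dirD_cont hφ1 hu)))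
    (intOn hb ((dirD_cont hφ1 hf).mul hu.continuous))
  exact eq_neg_of_add_eq_zero_left (h2.symm.trans h0)

lemma ibp_iter {D : Set (Rd 2)} {φ : Rd 2 → ℝ} (hb : Bornology.IsBounded D)
    (hD : D = {x | 0 < φ x}) {R γ : ℝ} (hγ : γ ∈ Set.Ioo (0:ℝ) 1) (hR : 0 ≤ R)
    {m : ℕ} (hφ : MemCkγ (m + 2) γ φ) {g ψ : Rd 2 → ℂ}
    (hg : A (Metric.closedBall 0 R) γ m g) (hψ : A (Metric.closedBall 0 R) γ (m + 2) ψ) (j : ℕ)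
    (hj : j ≤ m) :
    ∫ x in D, g x * (dirD (perpGrad φ))^[m + 1] ψ x =
      (-1) ^ j * ∫ x in D, (dirD (perpGrad φ))^[j] g x *
        (dirD (perpGrad φ))^[m + 1 - j] ψ x := by
  have hφ2 : ContDiff ℝ 2 φ := hφ.1.of_le (two_le_aux m)
  have hW := A_W hγ hR (m := m + 1) hφ
  induction j with
  | zero => simp
  | succ j ih =>
    rw [ih (by omega)]
    have e1 : m + 1 - j = (m + 1 - (j + 1)) + 1 := by omega
    rw [e1]
    simp only [Function.iterate_succ_apply']
    have hf : ContDiff ℝ 1 ((dirD (perpGrad φ))^[j] g) :=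
      (A_iter hγ hR hW j 1 (by omega) (A_le hγ hR (by omega) hg) (by omega)).1
    have hu : ContDiff ℝ 1 ((dirD (perpGrad φ))^[m + 1 - (j + 1)] ψ) :=
      (A_iter hγ hR hW (m + 1 - (j + 1)) 1 (by omega) (A_le hγ hR (by omega) hψ) (by omega)).1
    rw [ibp_D hb hD hφ2 hf hu]
    rw [pow_succ]; ring

lemma kernel_nice {γ : ℝ} (hγ : γ ∈ Set.Ioo (0:ℝ) 1) {m : Rd 2 → ℝ}
    (hm : ContDiff ℝ (⊤ : ℕ∞) m) {r : ℝ} (hs : ∀ ξ, m ξ ≠ 0 → ‖ξ‖ ≤ r) :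
    ContDiff ℝ (⊤ : ℕ∞) (𝓕⁻ (fun ξ => ((m ξ : ℝ) : ℂ))) ∧
    ∀ i, Integrable (fun z => ‖z‖ ^ γ * ‖pd i (𝓕⁻ (fun ξ => ((m ξ : ℝ) : ℂ))) z‖) := by
  have h1 : HasCompactSupport (fun ξ => ((m ξ : ℝ) : ℂ)) := by
    refine HasCompactSupport.intro (isCompact_closedBall (0 : Rd 2) r) (fun x hx => ?_)
    have : m x = 0 := by
      by_contra h
      exact hx (by simpa using hs x h)
    simp [this]
  have h2 : ContDiff ℝ (⊤ : ℕ∞) (fun ξ => ((m ξ : ℝ) : ℂ)) := Complex.ofRealCLM.contDiff.comp hm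
  let S : SchwartzMap (Rd 2) ℂ := h1.toSchwartzMap h2
  have hS : 𝓕⁻ (fun ξ => ((m ξ : ℝ) : ℂ)) = ((𝓕⁻ S : SchwartzMap (Rd 2) ℂ) : Rd 2 → ℂ) := by
    rw [SchwartzMap.fourierInv_coe]; rfl
  rw [hS]
  refine ⟨(𝓕⁻ S).smooth _, fun i => ?_⟩
  let T : SchwartzMap (Rd 2) ℂ := SchwartzMap.evalCLM ℝ (Rd 2) ℂ (e 2 i)
    (SchwartzMap.fderivCLM ℝ (Rd 2) ℂ (𝓕⁻ S))
  have hT : ∀ z, pd i (𝓕⁻ S : SchwartzMap (Rd 2) ℂ) z = T z := fun z => rfl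
  simp only [hT]
  have hI := (T.integrable_pow_mul volume 0).add (T.integrable_pow_mul volume 1)
  refine hI.mono' ?_ (Eventually.of_forall fun z => ?_)
  · exact ((continuous_norm.rpow_const (fun _ => Or.inr hγ.1.le)).mul
      T.continuous.norm).aestronglyMeasurable
  · have hp : 0 ≤ ‖z‖ ^ γ := by positivity
    rw [Real.norm_of_nonneg (by positivity)]
    have : ‖z‖ ^ γ ≤ 1 + ‖z‖ := by
      rcases le_total ‖z‖ 1 with h | h
      · have := Real.rpow_le_one (norm_nonneg z) h hγ.1.le
        linarith [norm_nonneg z]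
      · have := Real.rpow_le_rpow_of_exponent_le h hγ.2.le
        rw [Real.rpow_one] at this
        linarith
    calc ‖z‖ ^ γ * ‖T z‖ ≤ (1 + ‖z‖) * ‖T z‖ := by gcongr
      _ = _ := by simp; ring

lemma kernel_scale (m : Rd 2 → ℂ) {c : ℝ} (hc : 0 < c) (x : Rd 2) :
    𝓕⁻ (fun ξ => m (c⁻¹ • ξ)) x = (c : ℂ) ^ 2 * 𝓕⁻ m (c • x) := by
  rw [Real.fourierInv_eq, Real.fourierInv_eq]
  have h := Measure.integral_comp_inv_smul_of_nonneg (volume : Measure (Rd 2))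
    (fun v => 𝐞 (inner ℝ v (c • x)) • m v) hc.le
  have h2 : ∀ v : Rd 2, inner ℝ (c⁻¹ • v) (c • x) = inner ℝ v x := fun v => by
    rw [inner_smul_left, inner_smul_right]; simp; field_simp
  simp only [h2] at h
  rw [h]
  simp

lemma moment_scale {γ : ℝ} {K : Rd 2 → ℂ} (hK : Differentiable ℝ K)
    {c : ℝ} (hc : 0 < c) (i : Fin 2) :
    ∫ z, ‖z‖ ^ γ * ‖pd i (fun x => (c : ℂ) ^ 2 * K (c • x)) z‖ =
      c ^ (1 - γ) * ∫ z, ‖z‖ ^ γ * ‖pd i K z‖ := by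
  have hp : ∀ z, pd i (fun x => (c : ℂ) ^ 2 * K (c • x)) z = (c : ℂ) ^ 3 * pd i K (c • z) := by
    intro z
    have h1 : HasFDerivAt (fun x : Rd 2 => c • x) (c • ContinuousLinearMap.id ℝ (Rd 2)) z :=
      (hasFDerivAt_id z).const_smul c
    have h2 := ((hK (c • z)).hasFDerivAt.comp z h1).const_mul ((c : ℂ) ^ 2)
    unfold pd
    have h3 := h2.fderiv
    simp only [Function.comp_def] at h3
    rw [h3]
    simp
    ring
  simp only [hp]
  have h := Measure.integral_comp_smul_of_nonneg (volume : Measure (Rd 2))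
    (fun z => ‖z‖ ^ γ * ‖pd i K z‖) c (hR := hc.le)
  have h4 : ∀ z : Rd 2, ‖z‖ ^ γ * ‖(c : ℂ) ^ 3 * pd i K (c • z)‖ =
      (c ^ 3 * c ^ (-γ)) * (‖c • z‖ ^ γ * ‖pd i K (c • z)‖) := fun z => by
    rw [norm_smul, Real.norm_of_nonneg hc.le, Real.mul_rpow hc.le (norm_nonneg _), norm_mul,
      norm_pow, Complex.norm_real, Real.norm_of_nonneg hc.le, Real.rpow_neg hc.le]
    have : c ^ γ ≠ 0 := by positivity
    field_simp
  simp only [h4]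
  rw [integral_const_mul, h]
  rw [sub_eq_add_neg, Real.rpow_add hc, Real.rpow_one]
  simp
  field_simp

lemma block_bound {k : ℕ} (hk : 2 ≤ k) {γ : ℝ} (hγ : γ ∈ Set.Ioo (0:ℝ) 1)
    {D : Set (Rd 2)} (hb : Bornology.IsBounded D) (hne : D.Nonempty)
    {φ : Rd 2 → ℝ} (hD : D = {x | 0 < φ x}) (hφ : MemCkγ k γ φ)
    {g : Rd 2 → ℝ} (hg : MemCkγ (k - 2) γ g) :
    ∃ C : ℝ, 0 ≤ C ∧ ∀ K : Rd 2 → ℂ, ContDiff ℝ (⊤ : ℕ∞) K →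
      (∀ i, Integrable (fun z => ‖z‖ ^ γ * ‖pd i K z‖)) → ∀ x : Rd 2,
      ‖∫ y in D, toC g y * (dirD (perpGrad φ))^[k - 1] (fun z => K (x - z)) y‖ ≤
        C * ∑ i, ∫ z, ‖z‖ ^ γ * ‖pd i K z‖ := by
  obtain ⟨m, rfl⟩ : ∃ m, k = m + 2 := ⟨k - 2, by omega⟩
  simp only [show m + 2 - 2 = m by omega, show m + 2 - 1 = m + 1 by omega] at hg ⊢
  obtain ⟨R, hR0, hR⟩ : ∃ R : ℝ, 0 ≤ R ∧ closure D ⊆ Metric.closedBall 0 R := by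
    obtain ⟨R, hR⟩ := hb.closure.subset_closedBall (0 : Rd 2)
    exact ⟨max R 0, le_max_right _ _, hR.trans (Metric.closedBall_subset_closedBall (le_max_left _ _))⟩
  have hφ2 : ContDiff ℝ 2 φ := hφ.1.of_le (two_le_aux m)
  have hφ1 : ContDiff ℝ 1 φ := hφ2.of_le (by norm_num)
  have hgA := A_of_mem (Metric.closedBall 0 R) hγ.1 hg
  have hW := A_W hγ hR0 (m := m + 1) hφ
  have hm : MeasurableSet D := by
    rw [hD]; exact (isOpen_lt continuous_const hφ2.continuous).measurableSet
  set h := (dirD (perpGrad φ))^[m] (toC g) with hh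
  have hA : A (Metric.closedBall 0 R) γ 0 h :=
    A_iter hγ hR0 hW m 0 (by omega) (by simpa using hgA) (by omega)
  obtain ⟨hhc, C, hC0, hC⟩ := hA
  have hMW : ∀ i : Fin 2, ∃ M, ∀ x ∈ Metric.closedBall (0 : Rd 2) R,
      ‖((perpGrad φ x i : ℝ) : ℂ)‖ ≤ M := fun i =>
    (isCompact_closedBall (0 : Rd 2) R).exists_bound_of_continuousOn (A_cont (hW i)).continuousOn
  choose M hM using hMW
  have hM0 : ∀ i, 0 ≤ M i := fun i => le_trans (norm_nonneg _) (hM i 0 (by simpa using hR0))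
  refine ⟨C * 2 ^ γ * (M 0 + M 1), by have := hM0 0; have := hM0 1; positivity, ?_⟩
  intro K hK hKi x
  set ψ : Rd 2 → ℂ := fun z => K (x - z) with hψ
  have hψc : ContDiff ℝ (⊤ : ℕ∞) ψ := hK.comp (contDiff_const.sub contDiff_id)
  have hψ1 : ContDiff ℝ 1 ψ := hψc.of_le (by exact_mod_cast le_top)
  have hψA : A (Metric.closedBall 0 R) γ (m + 2) ψ :=
    A_smooth hγ hR0 _ (hψc.of_le (WithTop.coe_le_coe.2 le_top))
  have hpψ : ∀ i y, pd i ψ y = - pd i K (x - y) := fun i y => by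
    have h1 : HasFDerivAt (fun z : Rd 2 => x - z) (-ContinuousLinearMap.id ℝ (Rd 2)) y :=
      (hasFDerivAt_id y).const_sub x
    have h2 := (hK.differentiable (by simp) (x - y)).hasFDerivAt.comp y h1
    have h3 := h2.fderiv
    simp only [Function.comp_def] at h3
    unfold pd
    rw [hψ, h3]
    simp
  obtain ⟨xs, hxs, hxd⟩ := hb.isCompact_closure.exists_infDist_eq_dist hne.closure x
  have key : ∫ y in D, toC g y * (dirD (perpGrad φ))^[m + 1] ψ y =
      (-1) ^ m * ∫ y in D, (h y - h xs) * dirD (perpGrad φ) ψ y := by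
    rw [ibp_iter hb hD hγ hR0 hφ hgA hψA m le_rfl]
    rw [show m + 1 - m = 1 by omega, Function.iterate_one, ← hh]
    congr 1
    have e0 : ∫ y in D, h xs * dirD (perpGrad φ) ψ y = 0 := by
      rw [integral_const_mul, int_dirD_zero hb hD hφ2 hψ1, mul_zero]
    have e1 := integral_sub (intOn hb (hhc.mul (dirD_cont hφ1 hψ1)))
      (intOn hb (continuous_const.mul (dirD_cont hφ1 hψ1)) (f := fun y => h xs * dirD (perpGrad φ) ψ y))
    rw [e0, sub_zero] at e1
    rw [show (fun y => (h y - h xs) * dirD (perpGrad φ) ψ y) =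
      fun y => h y * dirD (perpGrad φ) ψ y - h xs * dirD (perpGrad φ) ψ y from
      funext fun y => by ring]
    exact e1.symm
  rw [key, norm_mul, norm_pow, norm_neg, norm_one, one_pow, one_mul]
  have hBi : ∀ i, Integrable (fun y => ‖x - y‖ ^ γ * ‖pd i K (x - y)‖) := fun i =>
    (hKi i).comp_sub_left x
  have hBI : ∀ i, ∫ y, ‖x - y‖ ^ γ * ‖pd i K (x - y)‖ = ∫ z, ‖z‖ ^ γ * ‖pd i K z‖ := fun i =>
    integral_sub_left_eq_self (fun z => ‖z‖ ^ γ * ‖pd i K z‖) volume x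
  let b : Rd 2 → ℝ := fun y => C * 2 ^ γ * (M 0 + M 1) *
    (‖x - y‖ ^ γ * ‖pd 0 K (x - y)‖ + ‖x - y‖ ^ γ * ‖pd 1 K (x - y)‖)
  have hbI : Integrable b := ((hBi 0).add (hBi 1)).const_mul _
  have hb0 : ∀ y, 0 ≤ b y := fun y => by
    have := hM0 0; have := hM0 1
    positivity
  calc ‖∫ y in D, (h y - h xs) * dirD (perpGrad φ) ψ y‖ ≤ ∫ y in D, b y := by
        refine norm_integral_le_of_norm_le hbI.integrableOn
          ((ae_restrict_iff' hm).2 (Eventually.of_forall fun y hy => ?_))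
        have hyB := hR (subset_closure hy)
        have hd : ‖y - xs‖ ≤ 2 * ‖x - y‖ := by
          have h1 : Metric.infDist x (closure D) ≤ dist x y :=
            Metric.infDist_le_dist_of_mem (subset_closure hy)
          rw [hxd] at h1
          have h2 := dist_triangle y x xs
          rw [dist_comm y x] at h2
          rw [← dist_eq_norm, ← dist_eq_norm]
          linarith
        have hH : ‖h y - h xs‖ ≤ C * 2 ^ γ * ‖x - y‖ ^ γ := by
          calc _ ≤ C * ‖y - xs‖ ^ γ := hC y hyB xs (hR hxs)
            _ ≤ C * (2 * ‖x - y‖) ^ γ := by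
              gcongr
              exact hγ.1.le
            _ = _ := by rw [Real.mul_rpow (by norm_num) (norm_nonneg _)]; ring
        have hDψ : ‖dirD (perpGrad φ) ψ y‖ ≤
            (M 0 + M 1) * (‖pd 0 K (x - y)‖ + ‖pd 1 K (x - y)‖) := by
          have e1 : dirD (perpGrad φ) ψ y = ((perpGrad φ y 0 : ℝ) : ℂ) * pd 0 ψ y +
            ((perpGrad φ y 1 : ℝ) : ℂ) * pd 1 ψ y := by simp [dirD, Fin.sum_univ_two]
          rw [e1, hpψ, hpψ]
          refine (norm_add_le _ _).trans ?_
          rw [norm_mul, norm_mul, norm_neg, norm_neg]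
          have a0 := mul_le_mul_of_nonneg_right (hM 0 y hyB) (norm_nonneg (pd 0 K (x - y)))
          have a1 := mul_le_mul_of_nonneg_right (hM 1 y hyB) (norm_nonneg (pd 1 K (x - y)))
          have a2 := mul_nonneg (hM0 0) (norm_nonneg (pd 1 K (x - y)))
          have a3 := mul_nonneg (hM0 1) (norm_nonneg (pd 0 K (x - y)))
          linarith
        rw [norm_mul]
        calc _ ≤ (C * 2 ^ γ * ‖x - y‖ ^ γ) *
              ((M 0 + M 1) * (‖pd 0 K (x - y)‖ + ‖pd 1 K (x - y)‖)) :=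
              mul_le_mul hH hDψ (norm_nonneg _) (by positivity)
          _ = b y := by simp only [b]; ring
    _ ≤ ∫ y, b y := setIntegral_le_integral hbI (Eventually.of_forall hb0)
    _ = _ := by
        simp only [b]
        rw [integral_const_mul, integral_add (hBi 0) (hBi 1), hBI, hBI, Fin.sum_univ_two]

end StriAux



open Paper in
/-- Lemma 2.6: for a temperature front `θ₀ = θ̄₀ 1_{D₀}` with a
`C^{k,γ}` level-set boundary and `θ̄₀ ∈ C^{k-2,γ}(cl D₀)`, the `(k-1)`-fold striated derivative
`∂_{W₀}^{k-1}θ₀` (taken in the sense of distributions, `W₀ = ∇^⊥φ₀`) belongs to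
`C^{-1,γ} = B^{γ-1}_{∞,∞}`. -/
theorem statement11 (k : ℕ) (hk : 2 ≤ k) (γ : ℝ) (hγ : γ ∈ Set.Ioo (0:ℝ) 1)
    (P : LPData 2)
    (D₀ : Set (Rd 2)) (hD : NiceDomain D₀)
    (φ₀ : Rd 2 → ℝ) (hls : IsLevelSet D₀ φ₀) (hφreg : MemCkγ k γ φ₀)
    (θb : Rd 2 → ℝ) (hθbm : Measurable θb)
    (hθb : ∃ g : Rd 2 → ℝ, MemCkγ (k - 2) γ g ∧ Set.EqOn g θb (closure D₀)) :
    (⨆ q : ℤ, (if -1 ≤ q then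
        dyadic (γ - 1) q *
          supNorm (blockDirPow P (perpGrad φ₀) (k - 1) (Set.indicator D₀ θb) q)
      else 0)) < ⊤ := by
  obtain ⟨g, hg, hgθ⟩ := hθb
  obtain ⟨C, hC0, hC⟩ := StriAux.block_bound hk hγ hD.bounded hD.nonempty hls.pos hφreg hg
  obtain ⟨hχ1, hχ2⟩ := StriAux.kernel_nice hγ P.chi_smooth P.chi_support
  obtain ⟨hϕ1, hϕ2⟩ := StriAux.kernel_nice hγ P.phi_smooth (fun ξ h => (P.phi_support ξ h).2)
  set Kχ := 𝓕⁻ (fun ξ => ((P.chi ξ : ℝ) : ℂ)) with hKχ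
  set Kϕ := 𝓕⁻ (fun ξ => ((P.phi ξ : ℝ) : ℂ)) with hKϕ
  have hblock : ∀ q x, ‖blockDirPow P (perpGrad φ₀) (k - 1) (Set.indicator D₀ θb) q x‖ =
      ‖∫ y in D₀, toC g y * (dirD (perpGrad φ₀))^[k - 1]
        (fun z => 𝓕⁻ (fun ξ => ((P.symb q ξ : ℝ) : ℂ)) (x - z)) y‖ := fun q x => by
    unfold blockDirPow
    rw [norm_mul, norm_pow, norm_neg, norm_one, one_pow, one_mul,
      ← integral_indicator hD.isOpen.measurableSet]
    congr 2
    funext y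
    by_cases hy : y ∈ D₀
    · rw [Set.indicator_of_mem hy, Set.indicator_of_mem hy, ← hgθ (subset_closure hy)]
      rfl
    · rw [Set.indicator_of_notMem hy, Set.indicator_of_notMem hy]
      simp
  set Nχ := ∑ i, ∫ z, ‖z‖ ^ γ * ‖pd i Kχ z‖ with hNχ
  set Nϕ := ∑ i, ∫ z, ‖z‖ ^ γ * ‖pd i Kϕ z‖ with hNϕ
  have hNχ0 : 0 ≤ Nχ := Finset.sum_nonneg fun i _ => integral_nonneg fun z => by positivity
  have hNϕ0 : 0 ≤ Nϕ := Finset.sum_nonneg fun i _ => integral_nonneg fun z => by positivity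
  have main : ∀ q : ℤ, -1 ≤ q → ∀ x,
      (2 : ℝ) ^ ((q : ℝ) * (γ - 1)) *
        ‖blockDirPow P (perpGrad φ₀) (k - 1) (Set.indicator D₀ θb) q x‖ ≤
      2 ^ (1 - γ) * (C * Nχ) + C * Nϕ := by
    intro q hq x
    rw [hblock]
    by_cases h1 : q = -1
    · have e1 : 𝓕⁻ (fun ξ => ((P.symb q ξ : ℝ) : ℂ)) = Kχ := by
        simp [LPData.symb, h1, hKχ]
      have e2 : (q : ℝ) * (γ - 1) = 1 - γ := by rw [h1]; push_cast; ring
      rw [e1, e2]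
      have := hC Kχ hχ1 hχ2 x
      have h3 : 0 ≤ C * Nϕ := by positivity
      have h4 := mul_le_mul_of_nonneg_left this (by positivity : (0:ℝ) ≤ 2 ^ (1 - γ))
      linarith
    · set c : ℝ := (2 : ℝ) ^ (q : ℝ) with hc
      have hc0 : 0 < c := by positivity
      have e1 : 𝓕⁻ (fun ξ => ((P.symb q ξ : ℝ) : ℂ)) = fun x => (c : ℂ) ^ 2 * Kϕ (c • x) := by
        funext x
        rw [hKϕ, ← StriAux.kernel_scale _ hc0]
        simp [LPData.symb, h1, hc]
      have e2 : ∑ i, ∫ z, ‖z‖ ^ γ * ‖pd i (fun x => (c : ℂ) ^ 2 * Kϕ (c • x)) z‖ =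
          c ^ (1 - γ) * Nϕ := by
        rw [hNϕ, Finset.mul_sum]
        exact Finset.sum_congr rfl fun i _ =>
          StriAux.moment_scale (hϕ1.differentiable (by simp)) hc0 i
      obtain ⟨h5, h6⟩ := StriAux.kernel_nice (m := P.symb q) (r := (8 / 3) * c) hγ (by
          have : P.symb q = fun ξ => P.phi ((2 : ℝ) ^ (-q) • ξ) := by
            funext ξ; simp [LPData.symb, h1]
          rw [this]
          exact P.phi_smooth.comp (contDiff_const_smul _)) (by
          intro ξ hξ
          simp only [LPData.symb, h1, if_false] at hξ
          have := (P.phi_support _ hξ).2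
          rw [norm_smul, Real.norm_of_nonneg (by positivity), zpow_neg, ← Real.rpow_intCast, ← hc]
            at this
          rwa [inv_mul_le_iff₀ hc0, mul_comm] at this)
      have h7 := hC _ h5 h6 x
      rw [e1, e2] at h7
      rw [e1]
      have h3 : 0 ≤ 2 ^ (1 - γ) * (C * Nχ) := by positivity
      have h8 : (2 : ℝ) ^ ((q : ℝ) * (γ - 1)) = c ^ (γ - 1) := by
        rw [hc, ← Real.rpow_mul (by norm_num)]
      rw [h8]
      have h9 : c ^ (γ - 1) * c ^ (1 - γ) = 1 := by
        rw [← Real.rpow_add hc0]; simp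
      have h4 := mul_le_mul_of_nonneg_left h7 (by positivity : (0:ℝ) ≤ c ^ (γ - 1))
      have h10 : c ^ (γ - 1) * (C * (c ^ (1 - γ) * Nϕ)) = C * Nϕ := by
        calc _ = (c ^ (γ - 1) * c ^ (1 - γ)) * (C * Nϕ) := by ring
          _ = _ := by rw [h9, one_mul]
      linarith
  refine lt_of_le_of_lt (iSup_le fun q => ?_)
    (ENNReal.ofReal_lt_top (r := 2 ^ (1 - γ) * (C * Nχ) + C * Nϕ))
  split_ifs with hq
  · unfold supNorm dyadic
    rw [ENNReal.mul_iSup]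
    refine iSup_le fun x => ?_
    rw [← enorm_eq_nnnorm, ← ofReal_norm, ← ENNReal.ofReal_mul (by positivity)]
    exact ENNReal.ofReal_le_ofReal (main q hq x)
  · exact bot_le
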